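/- arXiv:1301.1053 — 6 statements merged into one kernel-verified Lean document; each statement's English description precedes it below -/
import Mathlib

section
/- Let C be a category with binary products, a terminal object, and pullbacks, and let A be an object of C. Write m = ⟨π₁, id⟩ : A ⨯ A ⟶ A ⨯ (A ⨯ A) for the morphism with components the first projection and the identity of A ⨯ A (so elementwise (a,b) ↦ (a,(a,b))), and n = ⟨π₁, ⟨π₂, π₂⟩⟩ : A ⨯ A ⟶ A ⨯ (A ⨯ A) (elementwise (a,b) ↦ (a,(b,b))). Then the two induced legs of the pullback of m and n into A coincide, i.e. pullback.fst ≫ π₂ = pullback.snd ≫ π₁ as morphisms pullback m n ⟶ A, and this common morphism is an isomorphism. This expresses that in the bicategory of spans in C the composite span (A ⊗ e_A) ∘ (i_A ⊗ A), transported along the unitor and associator spans, is isomorphic to the identity span on A (the zig-zag 2-isomorphism ζ_A). -/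
open CategoryTheory CategoryTheory.Limits

/-- If `m` and `n` are given on elements by `(a, b) ↦ (a, (a, b))` and `(a, b) ↦ (a, (b, b))`,
then the pullback of `m` and `n` is `A`, embedded diagonally on both sides. -/
theorem pullback_fst_snd_eq_and_isIso {C : Type*} [Category C] [HasBinaryProducts C]
    {A : C} {m n : A ⨯ A ⟶ A ⨯ (A ⨯ A)} [HasPullback m n]
    (hm₁ : m ≫ prod.fst = prod.fst) (hm₂ : m ≫ prod.snd = 𝟙 (A ⨯ A))
    (hn₁ : n ≫ prod.fst = prod.fst) (hn₂ : n ≫ prod.snd = prod.lift prod.snd prod.snd) :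
    pullback.fst m n ≫ prod.snd = pullback.snd m n ≫ prod.fst ∧
      IsIso (pullback.fst m n ≫ prod.snd) := by
  have hw : pullback.fst m n ≫ m = pullback.snd m n ≫ n := pullback.condition
  have h₁ : pullback.fst m n ≫ prod.fst = pullback.snd m n ≫ prod.fst := by
    simpa only [Category.assoc, hm₁, hn₁] using hw =≫ prod.fst
  have h : pullback.fst m n = pullback.snd m n ≫ prod.lift prod.snd prod.snd := by
    rw [← hn₂, ← reassoc_of% hw, hm₂, Category.comp_id]
  have h₂ : pullback.fst m n ≫ prod.fst = pullback.snd m n ≫ prod.snd := by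
    rw [h, Category.assoc, prod.lift_fst]
  have h₃ : pullback.fst m n ≫ prod.snd = pullback.snd m n ≫ prod.snd := by
    rw [h, Category.assoc, prod.lift_snd]
  have hd : prod.lift (𝟙 A) (𝟙 A) ≫ m = prod.lift (𝟙 A) (𝟙 A) ≫ n := by
    apply prod.hom_ext
    · rw [Category.assoc, Category.assoc, hm₁, hn₁]
    · rw [Category.assoc, Category.assoc, hm₂, hn₂, Category.comp_id, prod.comp_lift,
        prod.lift_snd]
  refine ⟨h₃.trans (h₂.symm.trans h₁),
    pullback.lift (prod.lift (𝟙 A) (𝟙 A)) (prod.lift (𝟙 A) (𝟙 A)) hd, ?_, ?_⟩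
  · apply pullback.hom_ext <;> apply prod.hom_ext <;>
      simp only [Category.assoc, Category.id_comp, Category.comp_id,
        pullback.lift_fst_assoc, pullback.lift_snd_assoc, prod.lift_fst, prod.lift_snd]
    · exact h₃.trans h₂.symm
    · exact h₃.trans (h₂.symm.trans h₁)
    · exact h₃
  · rw [pullback.lift_fst_assoc, prod.lift_snd]

/-- In a category with binary products, a terminal object, and pullbacks, the
composite span `(A ⊗ e_A) ∘ (i_A ⊗ A)` (transported along the unitor and
associator spans) is isomorphic to the identity span on `A`: the two legs of the
pullback of `m = ⟨π₁, id⟩` and `n = ⟨π₁, ⟨π₂, π₂⟩⟩` into `A` coincide, and the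
common morphism is an isomorphism (the zig-zag 2-isomorphism `ζ_A`). -/
theorem span_zigzag_zeta {C : Type*} [Category C]
    [HasBinaryProducts C] [HasTerminal C] [HasPullbacks C] (A : C) :
    pullback.fst
        (prod.lift prod.fst (𝟙 (A ⨯ A)) : A ⨯ A ⟶ A ⨯ (A ⨯ A))
        (prod.lift prod.fst (prod.lift prod.snd prod.snd) : A ⨯ A ⟶ A ⨯ (A ⨯ A))
        ≫ prod.snd
      = pullback.snd
        (prod.lift prod.fst (𝟙 (A ⨯ A)) : A ⨯ A ⟶ A ⨯ (A ⨯ A))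
        (prod.lift prod.fst (prod.lift prod.snd prod.snd) : A ⨯ A ⟶ A ⨯ (A ⨯ A))
        ≫ prod.fst ∧
    IsIso (pullback.fst
        (prod.lift prod.fst (𝟙 (A ⨯ A)) : A ⨯ A ⟶ A ⨯ (A ⨯ A))
        (prod.lift prod.fst (prod.lift prod.snd prod.snd) : A ⨯ A ⟶ A ⨯ (A ⨯ A))
        ≫ prod.snd) := by
  exact pullback_fst_snd_eq_and_isIso (prod.lift_fst _ _) (prod.lift_snd _ _)
    (prod.lift_fst _ _) (prod.lift_snd _ _)
end

section
/- Let C be a category with binary products, a terminal object, and pullbacks, and let A be an object of C. Write p = ⟨id, π₂⟩ : A ⨯ A ⟶ (A ⨯ A) ⨯ A (elementwise (a,b) ↦ ((a,b),b)) and q = ⟨⟨π₁, π₁⟩, π₂⟩ : A ⨯ A ⟶ (A ⨯ A) ⨯ A (elementwise (c,d) ↦ ((c,c),d)). Then the two induced legs of the pullback of p and q into A coincide, i.e. pullback.fst ≫ π₁ = pullback.snd ≫ π₂ as morphisms pullback p q ⟶ A, and this common morphism is an isomorphism. This expresses that in the bicategory of spans in C the composite span (e_A ⊗ A) ∘ (A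 ⊗ i_A), transported along the unitor and associator spans, is isomorphic to the identity span on A (the zig-zag 2-isomorphism θ_A). -/
open CategoryTheory CategoryTheory.Limits

/-- In a category with binary products, a terminal object, and pullbacks, the
composite span `(e_A ⊗ A) ∘ (A ⊗ i_A)` (transported along the unitor and
associator spans) is isomorphic to the identity span on `A`: the two legs of the
pullback of `p = ⟨id, π₂⟩` and `q = ⟨⟨π₁, π₁⟩, π₂⟩` into `A` coincide, and the
common morphism is an isomorphism (the zig-zag 2-isomorphism `θ_A`). -/
theorem span_zigzag_theta {C : Type*} [Category C]
    [HasBinaryProducts C] [HasTerminal C] [HasPullbacks C] (A : C) :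
    pullback.fst
        (prod.lift (𝟙 (A ⨯ A)) prod.snd : A ⨯ A ⟶ (A ⨯ A) ⨯ A)
        (prod.lift (prod.lift prod.fst prod.fst) prod.snd : A ⨯ A ⟶ (A ⨯ A) ⨯ A)
        ≫ prod.fst
      = pullback.snd
        (prod.lift (𝟙 (A ⨯ A)) prod.snd : A ⨯ A ⟶ (A ⨯ A) ⨯ A)
        (prod.lift (prod.lift prod.fst prod.fst) prod.snd : A ⨯ A ⟶ (A ⨯ A) ⨯ A)
        ≫ prod.snd ∧
    IsIso (pullback.fst
        (prod.lift (𝟙 (A ⨯ A)) prod.snd : A ⨯ A ⟶ (A ⨯ A) ⨯ A)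
        (prod.lift (prod.lift prod.fst prod.fst) prod.snd : A ⨯ A ⟶ (A ⨯ A) ⨯ A)
        ≫ prod.fst) := by
  set p : A ⨯ A ⟶ (A ⨯ A) ⨯ A := prod.lift (𝟙 (A ⨯ A)) prod.snd
  set q : A ⨯ A ⟶ (A ⨯ A) ⨯ A := prod.lift (prod.lift prod.fst prod.fst) prod.snd
  have hw : pullback.fst p q ≫ p = pullback.snd p q ≫ q := pullback.condition
  have h₁ : pullback.fst p q ≫ prod.fst = pullback.snd p q ≫ prod.fst := by
    simpa [p, q, prod.lift_fst, prod.lift_snd, prod.lift_fst_assoc]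
      using hw =≫ (prod.fst ≫ prod.fst)
  have h₂ : pullback.fst p q ≫ prod.snd = pullback.snd p q ≫ prod.fst := by
    simpa [p, q, prod.lift_fst, prod.lift_snd, prod.lift_fst_assoc]
      using hw =≫ (prod.fst ≫ prod.snd)
  have h₃ : pullback.fst p q ≫ prod.snd = pullback.snd p q ≫ prod.snd := by
    simpa [p, q, prod.lift_fst, prod.lift_snd, prod.lift_fst_assoc]
      using hw =≫ prod.snd
  have hd : diag A ≫ p = diag A ≫ q := by
    ext <;> simp [p, q, prod.lift_fst, prod.lift_snd]
  refine ⟨h₁.trans (h₂.symm.trans h₃), pullback.lift (diag A) (diag A) hd, ?_, by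
    simp [pullback.lift_fst_assoc, prod.lift_fst]⟩
  apply pullback.hom_ext <;> ext <;>
    simp [pullback.lift_fst, pullback.lift_snd, prod.lift_fst, prod.lift_snd, h₁, h₂, ← h₃]
end

section
/- Let C be a category with binary coproducts, an initial object, and pushouts, and let A be an object of C. Write u = [ι₁, id] : A ⨿ (A ⨿ A) ⟶ A ⨿ A for the morphism given by the coprojection ι₁ : A ⟶ A ⨿ A on the first summand and the identity on the second, and v = [ι₁, [ι₂, ι₂]] : A ⨿ (A ⨿ A) ⟶ A ⨿ A. Then the two induced legs from A into the pushout of u and v coincide, i.e. ι₂ ≫ pushout.inl = ι₁ ≫ pushout.inr as morphisms A ⟶ pushout u v, and this common morphism is an isomorphism. This is the zig-zag isomorphism making every object self-dual in the bicategory of cospans in C, used to show that Cospan(ResNet) is compact closed. -/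
open CategoryTheory CategoryTheory.Limits

/-- In a category with binary coproducts, an initial object, and pushouts, the
zig-zag isomorphism making every object self-dual in the bicategory of cospans:
the two legs from `A` into the pushout of `u = [ι₁, id]` and `v = [ι₁, [ι₂, ι₂]]`
coincide, and the common morphism is an isomorphism. -/
theorem cospan_zigzag {C : Type*} [Category C]
    [HasBinaryCoproducts C] [HasInitial C] [HasPushouts C] (A : C) :
    coprod.inr ≫ pushout.inl
        (coprod.desc coprod.inl (𝟙 (A ⨿ A)) : A ⨿ (A ⨿ A) ⟶ A ⨿ A)
        (coprod.desc coprod.inl (coprod.desc coprod.inr coprod.inr) : A ⨿ (A ⨿ A) ⟶ A ⨿ A)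
      = coprod.inl ≫ pushout.inr
        (coprod.desc coprod.inl (𝟙 (A ⨿ A)) : A ⨿ (A ⨿ A) ⟶ A ⨿ A)
        (coprod.desc coprod.inl (coprod.desc coprod.inr coprod.inr) : A ⨿ (A ⨿ A) ⟶ A ⨿ A) ∧
    IsIso (coprod.inr ≫ pushout.inl
        (coprod.desc coprod.inl (𝟙 (A ⨿ A)) : A ⨿ (A ⨿ A) ⟶ A ⨿ A)
        (coprod.desc coprod.inl (coprod.desc coprod.inr coprod.inr) : A ⨿ (A ⨿ A) ⟶ A ⨿ A)) := by
  set u : A ⨿ (A ⨿ A) ⟶ A ⨿ A := coprod.desc coprod.inl (𝟙 (A ⨿ A)) with hu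
  set v : A ⨿ (A ⨿ A) ⟶ A ⨿ A :=
    coprod.desc coprod.inl (coprod.desc coprod.inr coprod.inr) with hv
  have inl_inl : coprod.inl ≫ pushout.inl u v = coprod.inl ≫ pushout.inr u v := by
    simpa [hu, hv, coprod.inl_desc, coprod.inr_desc]
      using coprod.inl ≫= pushout.condition (f := u) (g := v)
  have inl_inr : coprod.inl ≫ pushout.inl u v = coprod.inr ≫ pushout.inr u v := by
    simpa [hu, hv, coprod.inl_desc, coprod.inr_desc]
      using (coprod.inl ≫ coprod.inr) ≫= pushout.condition (f := u) (g := v)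
  have inr_inr : coprod.inr ≫ pushout.inl u v = coprod.inr ≫ pushout.inr u v := by
    simpa [hu, hv, coprod.inl_desc, coprod.inr_desc]
      using (coprod.inr ≫ coprod.inr) ≫= pushout.condition (f := u) (g := v)
  have inl_eq_inr : coprod.inr ≫ pushout.inl u v = coprod.inl ≫ pushout.inl u v :=
    inr_inr.trans inl_inr.symm
  refine ⟨inl_eq_inr.trans inl_inl, ?_⟩
  have hcodiag : u ≫ coprod.desc (𝟙 A) (𝟙 A) = v ≫ coprod.desc (𝟙 A) (𝟙 A) := by
    ext <;> simp [hu, hv, coprod.inl_desc, coprod.inr_desc]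
  refine ⟨pushout.desc (coprod.desc (𝟙 A) (𝟙 A)) (coprod.desc (𝟙 A) (𝟙 A)) hcodiag,
    by simp [pushout.inl_desc, coprod.inr_desc], ?_⟩
  apply pushout.hom_ext <;> apply coprod.hom_ext <;>
    simp [pushout.inl_desc_assoc, pushout.inr_desc_assoc,
      coprod.inl_desc, coprod.inr_desc, inl_eq_inr, ← inl_inl, ← inl_inr]
end

section
/- Let R be a monoidal category with an initial object and finite coproducts such that for every object X the functors X ⊗ − and − ⊗ X preserve finite coproducts. For matrices M : Fin m → Fin n → R, N : Fin n → Fin p → R, and P : Fin p → Fin q → R, and for every i : Fin m and l : Fin q, there is an isomorphism ((M·N)·P) i l ≅ (M·(N·P)) i l in R, where (M·N) i k = ∐_{j} (M i j ⊗ N j k). That is, composition of matrices over R is associative up to isomorphism, as required for Mat(R) to be a bicategory. -/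
open CategoryTheory CategoryTheory.Limits CategoryTheory.MonoidalCategory

/-- Iterated coproducts over two index types can be exchanged. -/
noncomputable def sigmaSigmaSwapIso {C : Type*} [Category C] {ι κ : Type*} (f : ι → κ → C)
    [∀ i, HasCoproduct (f i)] [HasCoproduct fun i => ∐ f i]
    [∀ k, HasCoproduct fun i => f i k] [HasCoproduct fun k => ∐ fun i => f i k] :
    (∐ fun i => ∐ f i) ≅ ∐ fun k => ∐ fun i => f i k where
  hom := Sigma.desc fun i => Sigma.desc fun k =>
    Sigma.ι (fun i => f i k) i ≫ Sigma.ι (fun k => ∐ fun i => f i k) k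
  inv := Sigma.desc fun k => Sigma.desc fun i =>
    Sigma.ι (f i) k ≫ Sigma.ι (fun i => ∐ f i) i

/-- Composition of matrices over a monoidal category `R` with finite coproducts
(whose tensor product preserves finite coproducts in each variable) is
associative up to isomorphism, entry by entry: this is needed for `Mat(R)` to be
a bicategory.  Here `(M·N) i k = ∐ j, M i j ⊗ N j k`. -/
theorem mat_comp_assoc {R : Type*} [Category R] [MonoidalCategory R]
    [HasInitial R] [HasFiniteCoproducts R]
    [∀ X : R, PreservesFiniteCoproducts (tensorLeft X)]
    [∀ X : R, PreservesFiniteCoproducts (tensorRight X)]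
    {m n p q : ℕ} (M : Fin m → Fin n → R) (N : Fin n → Fin p → R)
    (P : Fin p → Fin q → R) (i : Fin m) (l : Fin q) :
    Nonempty
      ((∐ fun k : Fin p => (∐ fun j : Fin n => M i j ⊗ N j k) ⊗ P k l) ≅
        (∐ fun j : Fin n => M i j ⊗ (∐ fun k : Fin p => N j k ⊗ P k l))) := by
  exact ⟨
    Sigma.mapIso (fun k =>
      PreservesCoproduct.iso (tensorRight (P k l)) (fun j => M i j ⊗ N j k) ≪≫
        Sigma.mapIso fun j => α_ (M i j) (N j k) (P k l)) ≪≫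
    sigmaSigmaSwapIso (fun k j => M i j ⊗ (N j k ⊗ P k l)) ≪≫
    Sigma.mapIso fun j =>
      (PreservesCoproduct.iso (tensorLeft (M i j)) fun k => N j k ⊗ P k l).symm⟩
end

section
/- Let R be a monoidal category with an initial object 0 and finite coproducts such that for every object X the functors X ⊗ − and − ⊗ X preserve finite coproducts, and let I denote the monoidal unit of R. Fix n and define matrices M : Fin n → (Fin n × Fin n × Fin n) → R by M m (a,b,c) = (if m = a then I else 0) ⊗ (if b = c then I else 0), and N : (Fin n × Fin n × Fin n) → Fin n → R by N (a,b,c) d = (if a = b then I else 0) ⊗ (if c = d then I else 0); these are the matrices of 1_n ⊗ e_n and i_n ⊗ 1_n, where i_n and e_n are the unit and counit exhibiting the object n of Mat(R) as self-dual. Then the composite matrix (M·N) m d = ∐_{(a,b,c)} (M m (a,b,c) ⊗ N (a,b,c) d) satisfies (M·N) m d ≅ I when m = d and (M·N) m d ≅ 0 when m ≠ d. That is, the composite of the unit and counit matrices is isomorphic, entry by entry, to the identity matrix. -/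
open CategoryTheory CategoryTheory.Limits CategoryTheory.MonoidalCategory

section

variable {C : Type*} [Category C]

/-- A coproduct of initial objects is initial. -/
noncomputable def isInitialSigma {ι : Type*} (f : ι → C) [HasCoproduct f]
    (hf : ∀ j, IsInitial (f j)) : IsInitial (∐ f) :=
  IsInitial.ofUniqueHom (fun Y => Sigma.desc fun j => (hf j).to Y)
    fun _ _ => Sigma.hom_ext _ _ fun j => (hf j).hom_ext _ _

open Classical in
/-- A coproduct with all summands but one initial is isomorphic to the remaining summand. -/
noncomputable def sigmaIsoOfIsInitial {ι : Type*} (f : ι → C) [HasCoproduct f] (i : ι)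
    (hf : ∀ j, j ≠ i → IsInitial (f j)) : ∐ f ≅ f i where
  hom := Sigma.desc fun j => if h : j = i then eqToHom (h ▸ rfl) else (hf j h).to _
  inv := Sigma.ι f i
  hom_inv_id := by
    refine Sigma.hom_ext _ _ fun j => ?_
    by_cases h : j = i
    · subst h
      simp
    · exact (hf j h).hom_ext _ _

variable [MonoidalCategory C]

/-- If `- ⊗ Y` preserves finite coproducts, then `X ⊗ Y` is initial when `X` is. -/
noncomputable def isInitialTensorOfLeft {X : C} (hX : IsInitial X) (Y : C)
    [PreservesFiniteCoproducts (tensorRight Y)] : IsInitial (X ⊗ Y) :=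
  hX.isInitialObj (tensorRight Y)

/-- If `X ⊗ -` preserves finite coproducts, then `X ⊗ Y` is initial when `Y` is. -/
noncomputable def isInitialTensorOfRight (X : C) {Y : C} (hY : IsInitial Y)
    [PreservesFiniteCoproducts (tensorLeft X)] : IsInitial (X ⊗ Y) :=
  hY.isInitialObj (tensorLeft X)

variable [HasInitial C] [∀ X : C, PreservesFiniteCoproducts (tensorLeft X)]
  [∀ X : C, PreservesFiniteCoproducts (tensorRight X)]

/-- A fourfold tensor product of units and initial objects is initial as soon as one of the
factors is. -/
theorem nonempty_isInitial_tensor_ite (p q r s : Prop) [Decidable p] [Decidable q] [Decidable r]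
    [Decidable s] (h : ¬(p ∧ q ∧ r ∧ s)) :
    Nonempty (IsInitial (((if p then 𝟙_ C else ⊥_ C) ⊗ (if q then 𝟙_ C else ⊥_ C)) ⊗
      ((if r then 𝟙_ C else ⊥_ C) ⊗ (if s then 𝟙_ C else ⊥_ C)))) := by
  have ite_initial (t : Prop) [Decidable t] (ht : ¬t) :
      Nonempty (IsInitial (if t then 𝟙_ C else ⊥_ C)) := by
    rw [if_neg ht]
    exact ⟨initialIsInitial⟩
  by_cases hp : p
  · by_cases hq : q
    · by_cases hr : r
      · obtain ⟨i⟩ := ite_initial s fun hs => h ⟨hp, hq, hr, hs⟩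
        exact ⟨isInitialTensorOfRight _ (isInitialTensorOfRight _ i)⟩
      · obtain ⟨i⟩ := ite_initial r hr
        exact ⟨isInitialTensorOfRight _ (isInitialTensorOfLeft i _)⟩
    · obtain ⟨i⟩ := ite_initial q hq
      exact ⟨isInitialTensorOfLeft (isInitialTensorOfRight _ i) _⟩
  · obtain ⟨i⟩ := ite_initial p hp
    exact ⟨isInitialTensorOfLeft (isInitialTensorOfLeft i _) _⟩

end

/-- In `Mat(R)`, the composite of the matrices of `1_n ⊗ e_n` and `i_n ⊗ 1_n`
(where `i_n`, `e_n` are the unit and counit exhibiting the object `n` as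
self-dual) is isomorphic, entry by entry, to the identity matrix: the entry
`(M·N) m d = ∐_{(a,b,c)} (M m (a,b,c) ⊗ N (a,b,c) d)` is isomorphic to the
monoidal unit `𝟙_ R` when `m = d` and to the initial object `⊥_ R` when
`m ≠ d`. -/
theorem mat_zigzag {R : Type*} [Category R] [MonoidalCategory R]
    [HasInitial R] [HasFiniteCoproducts R]
    [∀ X : R, PreservesFiniteCoproducts (tensorLeft X)]
    [∀ X : R, PreservesFiniteCoproducts (tensorRight X)]
    {n : ℕ} (m d : Fin n) :
    (m = d → Nonempty
      ((∐ fun x : Fin n × Fin n × Fin n =>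
          ((if m = x.1 then 𝟙_ R else ⊥_ R) ⊗ (if x.2.1 = x.2.2 then 𝟙_ R else ⊥_ R)) ⊗
            ((if x.1 = x.2.1 then 𝟙_ R else ⊥_ R) ⊗ (if x.2.2 = d then 𝟙_ R else ⊥_ R)))
        ≅ 𝟙_ R)) ∧
    (m ≠ d → Nonempty
      ((∐ fun x : Fin n × Fin n × Fin n =>
          ((if m = x.1 then 𝟙_ R else ⊥_ R) ⊗ (if x.2.1 = x.2.2 then 𝟙_ R else ⊥_ R)) ⊗
            ((if x.1 = x.2.1 then 𝟙_ R else ⊥_ R) ⊗ (if x.2.2 = d then 𝟙_ R else ⊥_ R)))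
        ≅ ⊥_ R)) := by
  constructor
  · rintro rfl
    refine ⟨sigmaIsoOfIsInitial _ (m, m, m) (fun x hx =>
      (nonempty_isInitial_tensor_ite _ _ _ _ ?_).some) ≪≫ ?_⟩
    · rintro ⟨h₁, h₂, h₃, h₄⟩
      exact hx (Prod.ext h₁.symm (Prod.ext (h₃.symm.trans h₁.symm) h₄))
    · simp only [if_true]
      exact (λ_ (𝟙_ R) ⊗ᵢ λ_ (𝟙_ R)) ≪≫ λ_ (𝟙_ R)
  · intro hmd
    refine ⟨(isInitialSigma _ fun x =>
      (nonempty_isInitial_tensor_ite _ _ _ _ ?_).some).uniqueUpToIso initialIsInitial⟩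
    rintro ⟨h₁, h₂, h₃, h₄⟩
    exact hmd (h₁.trans (h₃.trans (h₂.trans h₄)))
end

section
/- Let R be a symmetric monoidal category with an initial object 0 and finite coproducts such that for every object X the functors X ⊗ − and − ⊗ X preserve finite coproducts. For matrices M : Fin m → Fin n → R, N : Fin n → Fin p → R, M' : Fin m' → Fin n' → R, N' : Fin n' → Fin p' → R and all indices i, k, i', k', there is an isomorphism ((M·N) i k) ⊗ ((M'·N') i' k') ≅ ∐_{(j,j') : Fin n × Fin n'} (M i j ⊗ M' i' j') ⊗ (N j k ⊗ N' j' k') in R, where (M·N) i k = ∐_{j} (M i j ⊗ N j k). That is, the entrywise tensor product of composites is isomorphic to the composite of the entrywise tensor products, which is the interchange (tensorator) making the tensor product of matrices functorial in Mat(R). -/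
set_option maxHeartbeats 1000000

open CategoryTheory CategoryTheory.Limits CategoryTheory.MonoidalCategory

/-- Tensoring two finite coproducts gives the coproduct of the pairwise
tensor products, provided that tensoring on either side preserves finite coproducts. -/
noncomputable def tensorSigmaIso {C : Type*} [Category C] [MonoidalCategory C]
    [HasFiniteCoproducts C]
    [∀ X : C, PreservesFiniteCoproducts (tensorLeft X)]
    [∀ X : C, PreservesFiniteCoproducts (tensorRight X)]
    {ι κ : Type} [Finite ι] [Finite κ] (f : ι → C) (g : κ → C) :
    (∐ f) ⊗ (∐ g) ≅ ∐ fun x : ι × κ => f x.1 ⊗ g x.2 :=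
  PreservesCoproduct.iso (tensorRight (∐ g)) f ≪≫
    Sigma.mapIso (fun a => PreservesCoproduct.iso (tensorLeft (f a)) g) ≪≫
    sigmaSigmaIso (fun _ : ι => κ) (fun a b => f a ⊗ g b) ≪≫
    Sigma.whiskerEquiv (f := fun x : Σ _ : ι, κ => f x.1 ⊗ g x.2)
      (g := fun x : ι × κ => f x.1 ⊗ g x.2) (Equiv.sigmaEquivProd ι κ) (fun _ => Iso.refl _)

/-- The middle-four interchange `tensorμ` as an isomorphism. -/
def tensorMuIso {C : Type*} [Category C] [MonoidalCategory C] [BraidedCategory C]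
    (X₁ X₂ Y₁ Y₂ : C) : (X₁ ⊗ X₂) ⊗ Y₁ ⊗ Y₂ ≅ (X₁ ⊗ Y₁) ⊗ X₂ ⊗ Y₂ where
  hom := tensorμ X₁ X₂ Y₁ Y₂
  inv := tensorδ X₁ X₂ Y₁ Y₂

/-- The interchange (tensorator) for matrices over a symmetric monoidal category
`R` with an initial object and finite coproducts preserved by tensoring on each
side: the entrywise tensor product of composites is isomorphic to the composite
of the entrywise tensor products, `((M·N) i k) ⊗ ((M'·N') i' k') ≅
∐_{(j,j')} (M i j ⊗ M' i' j') ⊗ (N j k ⊗ N' j' k')`. -/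
theorem mat_tensorator {R : Type*} [Category R] [MonoidalCategory R] [SymmetricCategory R]
    [HasInitial R] [HasFiniteCoproducts R]
    [∀ X : R, PreservesFiniteCoproducts (tensorLeft X)]
    [∀ X : R, PreservesFiniteCoproducts (tensorRight X)]
    {m n p m' n' p' : ℕ}
    (M : Fin m → Fin n → R) (N : Fin n → Fin p → R)
    (M' : Fin m' → Fin n' → R) (N' : Fin n' → Fin p' → R)
    (i : Fin m) (k : Fin p) (i' : Fin m') (k' : Fin p') :
    Nonempty
      (((∐ fun j : Fin n => M i j ⊗ N j k) ⊗ (∐ fun j' : Fin n' => M' i' j' ⊗ N' j' k')) ≅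
        ∐ fun jj : Fin n × Fin n' => (M i jj.1 ⊗ M' i' jj.2) ⊗ (N jj.1 k ⊗ N' jj.2 k')) := by
  exact ⟨tensorSigmaIso _ _ ≪≫ Sigma.mapIso fun _ => tensorMuIso _ _ _ _⟩
end
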